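/- arXiv:2410.06937 — 2 statements merged into one kernel-verified Lean document; each statement's English description precedes it below -/
import Mathlib

section
/- If X ~ N(μ, Σ), f : ℝ^d → ℝ is Lipschitz with E f(X) = 0, then for all x > 0, P(f(X) ≥ x) ≤ (E[f(X)⁺]/x) · exp(-x²/(2‖Σ^{1/2}∇f‖²_∞)), where f⁺ = max(f, 0). -/
open MeasureTheory Finset

/-- `X ~ N(m, S)` on `ℝ^d`, expressed via the characteristic function. -/
def IsGaussianMeasure {d : ℕ} (P : Measure (EuclideanSpace ℝ (Fin d)))
    (m : EuclideanSpace ℝ (Fin d)) (S : Matrix (Fin d) (Fin d) ℝ) : Prop :=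
  IsProbabilityMeasure P ∧
  ∀ t : EuclideanSpace ℝ (Fin d),
    ∫ x, Complex.exp (Complex.I * ((∑ i, t i * x i : ℝ) : ℂ)) ∂P =
      Complex.exp (Complex.I * ((∑ i, m i * t i : ℝ) : ℂ) -
        ((∑ i, ∑ j, S i j * t i * t j : ℝ) : ℂ) / 2)

/-- `(X_α, Y_α)` Gaussian on `ℝ^d × ℝ^d` with mean `(m, m)` and block covariance
`[[S, αS], [αS, S]]`, expressed via the characteristic function. -/
def IsJointGaussianMeasure {d : ℕ}
    (Q : Measure (EuclideanSpace ℝ (Fin d) × EuclideanSpace ℝ (Fin d)))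
    (m : EuclideanSpace ℝ (Fin d)) (S : Matrix (Fin d) (Fin d) ℝ) (α : ℝ) : Prop :=
  IsProbabilityMeasure Q ∧
  ∀ t s : EuclideanSpace ℝ (Fin d),
    ∫ p, Complex.exp (Complex.I * ((∑ i, t i * p.1 i + ∑ i, s i * p.2 i : ℝ) : ℂ)) ∂Q =
      Complex.exp (Complex.I * ((∑ i, m i * (t i + s i) : ℝ) : ℂ) -
        (((∑ i, ∑ j, S i j * t i * t j) + (∑ i, ∑ j, S i j * s i * s j)
          + 2 * α * (∑ i, ∑ j, S i j * t i * s j) : ℝ) : ℂ) / 2)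

section helpers
open ProbabilityTheory

noncomputable def gw {d : ℕ} (v : EuclideanSpace ℝ (Fin d)) : ℝ :=
  (2 * Real.pi) ^ (-(d / 2 : ℝ)) * Real.exp (-(1/2) * ‖v‖ ^ 2)

lemma gw_integrable {d : ℕ} : Integrable (gw (d := d)) := by
  unfold gw
  apply Integrable.const_mul
  have h : Integrable fun v : EuclideanSpace ℝ (Fin d) ↦
      Complex.exp (-((1/2 : ℝ) : ℂ) * ‖v‖ ^ 2 + 0 * inner ℝ (0 : EuclideanSpace ℝ (Fin d)) v) :=
    GaussianFourier.integrable_cexp_neg_mul_sq_norm_add (by norm_num) _ _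
  refine h.norm.congr (ae_of_all _ fun v => ?_)
  simp only [Complex.norm_exp]
  congr 1
  simp [← Complex.ofReal_pow]

lemma gw_nonneg {d : ℕ} (v : EuclideanSpace ℝ (Fin d)) : 0 ≤ gw v := by
  unfold gw; positivity

lemma gw_continuous {d : ℕ} : Continuous (gw (d := d)) := by
  unfold gw; fun_prop

lemma stdGaussian_eq_withDensity {d : ℕ} :
    stdGaussian (EuclideanSpace ℝ (Fin d)) =
      volume.withDensity (fun v => ENNReal.ofReal (gw v)) := by
  have : IsFiniteMeasure ((volume : Measure (EuclideanSpace ℝ (Fin d))).withDensity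
      (fun v => ENNReal.ofReal (gw v))) :=
    isFiniteMeasure_withDensity_ofReal gw_integrable.2
  apply Measure.ext_of_charFun
  ext t
  rw [charFun_stdGaussian, charFun_apply, integral_withDensity_eq_integral_toReal_smul
    (by have := gw_continuous (d := d); fun_prop) (by simp)]
  have h := GaussianFourier.integral_cexp_neg_mul_sq_norm_add (V := EuclideanSpace ℝ (Fin d))
    (b := ((1/2 : ℝ) : ℂ)) (by norm_num) Complex.I t
  have e : ∀ x : EuclideanSpace ℝ (Fin d),
      (ENNReal.ofReal (gw x)).toReal • Complex.exp ((inner ℝ x t : ℝ) * Complex.I) =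
      (((2 * Real.pi) ^ (-(d / 2 : ℝ)) : ℝ) : ℂ) * Complex.exp (-((1/2 : ℝ) : ℂ) * ‖x‖ ^ 2 + Complex.I * (inner ℝ t x : ℝ)) := by
    intro x
    rw [ENNReal.toReal_ofReal (gw_nonneg x), Complex.real_smul, gw, Complex.exp_add,
      real_inner_comm]
    push_cast
    ring_nf
  simp_rw [e]
  rw [integral_const_mul, h]
  have e2 : (Real.pi : ℂ) / ((1/2 : ℝ) : ℂ) = ((2 * Real.pi : ℝ) : ℂ) := by push_cast; ring
  have e3 : ((Module.finrank ℝ (EuclideanSpace ℝ (Fin d)) : ℂ) / 2) = ((d / 2 : ℝ) : ℂ) := by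
    simp
  rw [e2, e3, ← Complex.ofReal_cpow (by positivity), ← mul_assoc, ← Complex.ofReal_mul,
    ← Real.rpow_add (by positivity)]
  simp
  ring_nf

lemma integral_stdG {d : ℕ} (F : EuclideanSpace ℝ (Fin d) → ℝ) :
    ∫ v, F v ∂(stdGaussian (EuclideanSpace ℝ (Fin d))) = ∫ v, gw v * F v := by
  rw [stdGaussian_eq_withDensity, integral_withDensity_eq_integral_toReal_smul
    (by have := gw_continuous (d := d); fun_prop) (by simp)]
  congr 1; ext v
  rw [ENNReal.toReal_ofReal (gw_nonneg v), smul_eq_mul]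

lemma integrable_stdG {d : ℕ} (F : EuclideanSpace ℝ (Fin d) → ℝ)
    (h : Integrable F (stdGaussian (EuclideanSpace ℝ (Fin d)))) : Integrable fun v => gw v * F v := by
  rw [stdGaussian_eq_withDensity, integrable_withDensity_iff_integrable_smul'
    (by have := gw_continuous (d := d); fun_prop) (by simp)] at h
  refine h.congr (ae_of_all _ fun v => ?_)
  simp [ENNReal.toReal_ofReal (gw_nonneg v)]

lemma integrable_norm_stdG {d : ℕ} :
    Integrable (fun v => ‖v‖) (stdGaussian (EuclideanSpace ℝ (Fin d))) :=
  IsGaussian.integrable_id.norm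

lemma gw_hasFDerivAt {d : ℕ} (v : EuclideanSpace ℝ (Fin d)) :
    HasFDerivAt gw (-(gw v) • innerSL ℝ v) v := by
  have h := (((hasStrictFDerivAt_norm_sq v).hasFDerivAt.const_mul (-(1/2) : ℝ)).exp).const_mul
    ((2 * Real.pi) ^ (-(d / 2 : ℝ)))
  refine h.congr_fderiv ?_
  ext w
  simp [gw]
  ring

lemma stein {d : ℕ} (k : EuclideanSpace ℝ (Fin d) → ℝ) (hk : ContDiff ℝ 1 k) (M D : ℝ)
    (hM : ∀ y, |k y| ≤ M) (hD : ∀ y, ‖fderiv ℝ k y‖ ≤ D) (a : EuclideanSpace ℝ (Fin d)) :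
    ∫ y, k y * inner ℝ a y ∂(stdGaussian (EuclideanSpace ℝ (Fin d))) =
      ∫ y, fderiv ℝ k y a ∂(stdGaussian (EuclideanSpace ℝ (Fin d))) := by
  have hc : Continuous fun y => fderiv ℝ k y a := (hk.continuous_fderiv (by simp)).clm_apply continuous_const
  have hkc := hk.continuous
  have i1 : Integrable (fun y => k y * inner ℝ a y) (stdGaussian (EuclideanSpace ℝ (Fin d))) := by
    refine (integrable_norm_stdG.const_mul (M * ‖a‖)).mono' (by fun_prop) (ae_of_all _ fun y => ?_)
    rw [norm_mul, mul_assoc]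
    have := norm_inner_le_norm (𝕜 := ℝ) a y
    have h0 : 0 ≤ M := (abs_nonneg _).trans (hM y)
    exact mul_le_mul (hM y) this (norm_nonneg _) h0
  have i2 : Integrable (fun y => fderiv ℝ k y a) (stdGaussian (EuclideanSpace ℝ (Fin d))) := by
    refine (integrable_const (D * ‖a‖)).mono' (by fun_prop) (ae_of_all _ fun y => ?_)
    exact (ContinuousLinearMap.le_opNorm _ _).trans (by gcongr; exact hD y)
  have i3 : Integrable k (stdGaussian (EuclideanSpace ℝ (Fin d))) :=
    (integrable_const M).mono' (by fun_prop) (ae_of_all _ hM)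
  rw [integral_stdG, integral_stdG]
  have e : ∀ y, fderiv ℝ gw y a * k y = -(gw y * (k y * inner ℝ a y)) := by
    intro y
    rw [(gw_hasFDerivAt y).fderiv]
    simp [real_inner_comm]
    ring
  rw [integral_mul_fderiv_eq_neg_fderiv_mul_of_integrable]
  · simp_rw [e, integral_neg, neg_neg]
  · simp_rw [e]; exact (integrable_stdG _ i1).neg
  · exact integrable_stdG _ i2
  · exact integrable_stdG _ i3
  · exact fun y _ => (gw_hasFDerivAt y).differentiableAt
  · exact fun y _ => hk.differentiable (by simp) y

abbrev EE (d : ℕ) := EuclideanSpace ℝ (Fin d)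
noncomputable abbrev gam (d : ℕ) : Measure (EE d) := stdGaussian (EE d)

lemma rot_eq {d : ℕ} (θ : ℝ) :
    ((gam d).prod (gam d)).map (ContinuousLinearMap.rotation θ) = (gam d).prod (gam d) :=
  IsGaussian.map_rotation_eq_self (by simp) θ

lemma integrable_norm_fst {d : ℕ} : Integrable (fun p : EE d × EE d => ‖p.1‖) ((gam d).prod (gam d)) :=
  (integrable_norm_stdG (d := d)).comp_fst _

lemma integrable_norm_snd {d : ℕ} : Integrable (fun p : EE d × EE d => ‖p.2‖) ((gam d).prod (gam d)) :=
  (integrable_norm_stdG (d := d)).comp_snd _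

lemma rot_integral {d : ℕ} (θ : ℝ) (F : EE d × EE d → ℝ) (hF : Continuous F) :
    ∫ p, F (ContinuousLinearMap.rotation θ p) ∂((gam d).prod (gam d)) =
      ∫ p, F p ∂((gam d).prod (gam d)) := by
  conv_rhs => rw [← rot_eq θ]
  rw [integral_map (by fun_prop) (hF.aestronglyMeasurable)]

lemma inner_bound {d : ℕ} (g h : EE d → ℝ) (hg : ContDiff ℝ 1 g) (hh : ContDiff ℝ 1 h)
    (L M D : ℝ) (hL : ∀ y, ‖fderiv ℝ g y‖ ≤ L) (hM : ∀ y, |h y| ≤ M)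
    (hD : ∀ y, ‖fderiv ℝ h y‖ ≤ D) (c s : ℝ) (hs : 0 ≤ s) (x : EE d) :
    -(s * L) * ∫ y, ‖fderiv ℝ h (c • x - s • y)‖ ∂(gam d) ≤
      ∫ y, h (c • x - s • y) * fderiv ℝ g x y ∂(gam d) := by
  set a : EE d := (InnerProductSpace.toDual ℝ (EE d)).symm (fderiv ℝ g x) with ha
  have hav : ∀ y, fderiv ℝ g x y = inner ℝ a y := by
    intro y; rw [ha, InnerProductSpace.toDual_symm_apply]
  have han : ‖a‖ ≤ L := by rw [ha, LinearIsometryEquiv.norm_map]; exact hL x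
  have hk : ContDiff ℝ 1 (fun y : EE d => h (c • x - s • y)) := by fun_prop
  have hfd : ∀ y : EE d, HasFDerivAt (fun y : EE d => h (c • x - s • y))
      (-s • fderiv ℝ h (c • x - s • y)) y := by
    intro y
    have h1 : HasFDerivAt (fun y : EE d => c • x - s • y) (-s • ContinuousLinearMap.id ℝ (EE d)) y := by
      have := ((hasFDerivAt_id (𝕜 := ℝ) y).const_smul s).const_sub (c • x)
      refine this.congr_fderiv ?_
      ext w; simp
    have h2 := ((hh.differentiable (by simp)) (c • x - s • y)).hasFDerivAt.comp y h1
    refine h2.congr_fderiv ?_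
    ext w; simp
  have hc : Continuous fun y : EE d => fderiv ℝ h (c • x - s • y) :=
    (hh.continuous_fderiv (by simp)).comp (by fun_prop)
  have hint : Integrable (fun y => ‖fderiv ℝ h (c • x - s • y)‖) (gam d) :=
    (integrable_const D).mono' hc.norm.aestronglyMeasurable (ae_of_all _ fun y => by simpa using hD _)
  simp_rw [hav]
  rw [stein _ hk M (s * D) (fun y => hM _) (fun y => by
    rw [(hfd y).fderiv, norm_smul, norm_neg, Real.norm_of_nonneg hs]; gcongr; exact hD _)]
  rw [← integral_const_mul]
  simp_rw [fun y => (hfd y).fderiv]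
  have hb : ∀ y, |fderiv ℝ h (c • x - s • y) a| ≤ L * ‖fderiv ℝ h (c • x - s • y)‖ := by
    intro y
    have := (fderiv ℝ h (c • x - s • y)).le_opNorm a
    rw [mul_comm]
    exact this.trans (by gcongr)
  refine integral_mono (hint.const_mul _) ?_ fun y => ?_
  · refine (hint.const_mul (s * L)).mono' ?_ (ae_of_all _ fun y => ?_)
    · exact Continuous.aestronglyMeasurable (by
        have := hc.clm_apply (continuous_const (y := a))
        exact this.const_smul (-s))
    · simp only [_root_.smul_apply, smul_eq_mul, norm_mul, norm_neg,
        Real.norm_eq_abs, abs_of_nonneg hs, mul_assoc]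
      exact mul_le_mul_of_nonneg_left (hb y) hs
  · have := mul_le_mul_of_nonneg_left ((le_abs_self _).trans (hb y)) hs
    simp only [FunLike.coe_smul, Pi.smul_apply, smul_eq_mul]
    nlinarith

lemma G_deriv {d : ℕ} (g h : EE d → ℝ) (hg : ContDiff ℝ 1 g) (hh : ContDiff ℝ 1 h)
    (L M : ℝ) (hL : ∀ y, ‖fderiv ℝ g y‖ ≤ L) (hM : ∀ y, |h y| ≤ M)
    (hgi : Integrable g (gam d)) (θ : ℝ) :
    HasDerivAt (fun θ : ℝ => ∫ p, h p.1 * g (Real.cos θ • p.1 + Real.sin θ • p.2) ∂((gam d).prod (gam d)))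
      (∫ p, h p.1 * fderiv ℝ g (Real.cos θ • p.1 + Real.sin θ • p.2)
        (-Real.sin θ • p.1 + Real.cos θ • p.2) ∂((gam d).prod (gam d))) θ := by
  have hgc := hg.continuous
  have hhc := hh.continuous
  have hdc := hg.continuous_fderiv (by simp)
  have h0 : 0 ≤ M := (abs_nonneg _).trans (hM 0)
  have h0L : 0 ≤ L := (norm_nonneg _).trans (hL 0)
  refine (hasDerivAt_integral_of_dominated_loc_of_deriv_le (s := Set.univ)
    (μ := (gam d).prod (gam d))
    (F := fun (θ : ℝ) (p : EE d × EE d) => h p.1 * g (Real.cos θ • p.1 + Real.sin θ • p.2))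
    (F' := fun (θ : ℝ) (p : EE d × EE d) => h p.1 * fderiv ℝ g (Real.cos θ • p.1 + Real.sin θ • p.2)
        (-Real.sin θ • p.1 + Real.cos θ • p.2))
    (bound := fun p : EE d × EE d => M * L * (‖p.1‖ + ‖p.2‖)) Filter.univ_mem ?_ ?_ ?_ ?_ ?_ ?_).2
  · exact Filter.Eventually.of_forall fun t => Continuous.aestronglyMeasurable (by fun_prop)
  · have i1 : Integrable (fun p : EE d × EE d => g (Real.cos θ • p.1 + Real.sin θ • p.2))
        ((gam d).prod (gam d)) := by
      have i2 : Integrable (fun p : EE d × EE d => g p.1) ((gam d).prod (gam d)) := hgi.comp_fst _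
      rw [← rot_eq θ] at i2
      have := i2.comp_measurable (by fun_prop)
      simpa [Function.comp_def, ContinuousLinearMap.rotation_apply] using this
    refine (i1.norm.const_mul M).mono' (Continuous.aestronglyMeasurable (by fun_prop)) (ae_of_all _ fun p => ?_)
    rw [norm_mul]
    gcongr
    exact hM _
  · exact Continuous.aestronglyMeasurable (by fun_prop)
  · refine ae_of_all _ fun p t _ => ?_
    rw [norm_mul, mul_assoc]
    refine mul_le_mul (hM _) ?_ (norm_nonneg _) h0
    refine (ContinuousLinearMap.le_opNorm _ _).trans ?_
    refine mul_le_mul (hL _) ?_ (norm_nonneg _) h0L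
    refine (norm_add_le _ _).trans ?_
    rw [norm_smul, norm_smul, norm_neg]
    have h1 := Real.abs_sin_le_one t
    have h2 := Real.abs_cos_le_one t
    simp only [Real.norm_eq_abs]
    nlinarith [norm_nonneg p.1, norm_nonneg p.2]
  · exact (integrable_norm_fst.add integrable_norm_snd).const_mul _
  · refine ae_of_all _ fun p t _ => ?_
    have h1 : HasDerivAt (fun t : ℝ => Real.cos t • p.1 + Real.sin t • p.2)
        (-Real.sin t • p.1 + Real.cos t • p.2) t :=
      ((Real.hasDerivAt_cos t).smul_const p.1).add ((Real.hasDerivAt_sin t).smul_const p.2)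
    exact (((hg.differentiable (by simp)) _).hasFDerivAt.comp_hasDerivAt t h1).const_mul _

lemma G_deriv_ge {d : ℕ} (g h : EE d → ℝ) (hg : ContDiff ℝ 1 g) (hh : ContDiff ℝ 1 h)
    (L M D : ℝ) (hL : ∀ y, ‖fderiv ℝ g y‖ ≤ L) (hM : ∀ y, |h y| ≤ M)
    (hD : ∀ y, ‖fderiv ℝ h y‖ ≤ D) (θ : ℝ) (hs : 0 ≤ Real.sin θ) :
    -(Real.sin θ * L) * ∫ y, ‖fderiv ℝ h y‖ ∂(gam d) ≤
      (∫ p, h p.1 * fderiv ℝ g (Real.cos θ • p.1 + Real.sin θ • p.2)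
        (-Real.sin θ • p.1 + Real.cos θ • p.2) ∂((gam d).prod (gam d))) := by
  have hgc := hg.continuous
  have hhc := hh.continuous
  have hdc := hg.continuous_fderiv (by simp)
  have hhdc := hh.continuous_fderiv (by simp)
  have h0 : 0 ≤ M := (abs_nonneg _).trans (hM 0)
  have h0L : 0 ≤ L := (norm_nonneg _).trans (hL 0)
  have e1 := rot_integral (d := d) θ
    (fun q => h (Real.cos θ • q.1 - Real.sin θ • q.2) * fderiv ℝ g q.1 q.2) (by fun_prop)
  have e1' : ∀ p : EE d × EE d, Real.cos θ • (ContinuousLinearMap.rotation θ p).1 -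
      Real.sin θ • (ContinuousLinearMap.rotation θ p).2 = p.1 := by
    intro p
    simp only [ContinuousLinearMap.rotation_apply, smul_add, smul_smul]
    have := Real.cos_sq_add_sin_sq θ
    calc _ = (Real.cos θ ^ 2 + Real.sin θ ^ 2) • p.1 := by module
      _ = p.1 := by rw [this, one_smul]
  simp_rw [e1'] at e1
  simp only [ContinuousLinearMap.rotation_apply] at e1
  rw [e1]
  have e2 := rot_integral (d := d) (-θ) (fun q => ‖fderiv ℝ h q.1‖) (by fun_prop)
  have e2' : ∫ y, ‖fderiv ℝ h y‖ ∂(gam d) =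
      ∫ p : EE d × EE d, ‖fderiv ℝ h (Real.cos θ • p.1 - Real.sin θ • p.2)‖ ∂((gam d).prod (gam d)) := by
    simp only [ContinuousLinearMap.rotation_apply, Real.cos_neg, Real.sin_neg, neg_smul,
      ← sub_eq_add_neg] at e2
    rw [e2, integral_fun_fst (fun y => ‖fderiv ℝ h y‖)]
    simp
  have i2 : Integrable (fun p : EE d × EE d => ‖fderiv ℝ h (Real.cos θ • p.1 - Real.sin θ • p.2)‖)
      ((gam d).prod (gam d)) :=
    (integrable_const D).mono' (Continuous.aestronglyMeasurable (by fun_prop))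
      (ae_of_all _ fun y => by simpa using hD _)
  have i1 : Integrable (fun q : EE d × EE d =>
      h (Real.cos θ • q.1 - Real.sin θ • q.2) * fderiv ℝ g q.1 q.2) ((gam d).prod (gam d)) := by
    refine (integrable_norm_snd.const_mul (M * L)).mono' (Continuous.aestronglyMeasurable (by fun_prop)) (ae_of_all _ fun p => ?_)
    rw [norm_mul, mul_assoc]
    refine mul_le_mul (hM _) ?_ (norm_nonneg _) h0
    refine (ContinuousLinearMap.le_opNorm _ _).trans ?_
    gcongr
    exact hL _
  rw [e2', integral_prod _ i2, integral_prod _ i1, ← integral_const_mul]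
  exact integral_mono (i2.integral_prod_left.const_mul _) i1.integral_prod_left
    fun x => inner_bound g h hg hh L M D hL hM hD _ _ hs x

lemma cov_bound {d : ℕ} (g h : EE d → ℝ) (hg : ContDiff ℝ 1 g) (hh : ContDiff ℝ 1 h)
    (L M D : ℝ) (hL : ∀ y, ‖fderiv ℝ g y‖ ≤ L) (hM : ∀ y, |h y| ≤ M)
    (hD : ∀ y, ‖fderiv ℝ h y‖ ≤ D) (hgi : Integrable g (gam d)) (hg0 : ∫ y, g y ∂(gam d) = 0) :
    ∫ y, h y * g y ∂(gam d) ≤ L * ∫ y, ‖fderiv ℝ h y‖ ∂(gam d) := by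
  set A := L * ∫ y, ‖fderiv ℝ h y‖ ∂(gam d) with hA
  set G := (fun θ : ℝ => ∫ p, h p.1 * g (Real.cos θ • p.1 + Real.sin θ • p.2) ∂((gam d).prod (gam d))) with hG
  have hder : ∀ θ, HasDerivAt (fun θ => G θ - A * Real.cos θ) _ θ := fun θ =>
    (G_deriv g h hg hh L M hL hM hgi θ).sub ((Real.hasDerivAt_cos θ).const_mul A)
  have hmono : MonotoneOn (fun θ => G θ - A * Real.cos θ) (Set.Icc 0 (Real.pi / 2)) := by
    refine monotoneOn_of_deriv_nonneg (convex_Icc _ _)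
      (fun θ _ => (hder θ).continuousAt.continuousWithinAt)
      (fun θ _ => (hder θ).differentiableAt.differentiableWithinAt) fun θ hθ => ?_
    rw [interior_Icc] at hθ
    rw [(hder θ).deriv]
    have := G_deriv_ge g h hg hh L M D hL hM hD θ
      (Real.sin_nonneg_of_nonneg_of_le_pi hθ.1.le (by linarith [hθ.2, Real.pi_pos]))
    rw [hA]
    nlinarith
  have hp := Real.pi_pos
  have := hmono (Set.left_mem_Icc.2 (by positivity)) (Set.right_mem_Icc.2 (by positivity)) (by positivity)
  simp only [hG, Real.cos_zero, Real.sin_zero, Real.cos_pi_div_two, Real.sin_pi_div_two, one_smul,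
    zero_smul, add_zero, zero_add, mul_one, mul_zero, sub_zero] at this
  rw [integral_fun_fst (fun y => h y * g y), integral_prod_mul h g, hg0] at this
  simp at this
  linarith

noncomputable def chi (x x' s : ℝ) : ℝ := max 0 (min 1 ((x - s) / (x - x')))
noncomputable def psi (K x x' s : ℝ) : ℝ := max s 0 / K * Real.exp (s ^ 2 / (2 * K)) * chi x x' s
noncomputable def phi (K x x' t : ℝ) : ℝ := ∫ s in (0:ℝ)..t, psi K x x' s

lemma chi_cont (x x' : ℝ) : Continuous (chi x x') := by unfold chi; fun_prop
lemma psi_cont (K x x' : ℝ) : Continuous (psi K x x') := by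
  have := chi_cont x x'
  unfold psi; fun_prop
lemma chi_nonneg (x x' s : ℝ) : 0 ≤ chi x x' s := le_max_left _ _
lemma chi_le_one (x x' s : ℝ) : chi x x' s ≤ 1 := max_le zero_le_one (min_le_left _ _)
lemma chi_anti {x x' : ℝ} (h : x' < x) : Antitone (chi x x') := by
  intro a b hab
  unfold chi
  have : 0 < x - x' := by linarith
  gcongr
lemma chi_one {x x' : ℝ} (h : x' < x) : chi x x' x' = 1 := by
  unfold chi
  rw [div_self (by linarith : x - x' ≠ 0)]; simp
lemma chi_zero {x x' s : ℝ} (h : x' < x) (hs : x ≤ s) : chi x x' s = 0 := by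
  unfold chi
  apply max_eq_left
  exact (min_le_right _ _).trans (div_nonpos_of_nonpos_of_nonneg (by linarith) (by linarith))
lemma psi_nonneg {K : ℝ} (hK : 0 < K) (x x' s : ℝ) : 0 ≤ psi K x x' s := by
  have := chi_nonneg x x' s
  unfold psi; positivity
lemma psi_zero_neg {K x x' s : ℝ} (hs : s ≤ 0) : psi K x x' s = 0 := by
  simp [psi, max_eq_right hs]
lemma psi_supp {K x x' : ℝ} (h : x' < x) : HasCompactSupport (psi K x x') := by
  refine HasCompactSupport.intro (isCompact_Icc (a := 0) (b := x)) fun s hs => ?_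
  rw [Set.mem_Icc, not_and_or] at hs
  rcases hs with hs | hs
  · exact psi_zero_neg (by linarith)
  · simp [psi, chi_zero h (by linarith : x ≤ s)]
lemma phi_deriv (K x x' t : ℝ) : HasDerivAt (phi K x x') (psi K x x' t) t :=
  intervalIntegral.integral_hasDerivAt_right ((psi_cont K x x').intervalIntegrable _ _)
    ((psi_cont K x x').stronglyMeasurableAtFilter _ _) (psi_cont K x x').continuousAt
lemma phi_contDiff (K x x' : ℝ) : ContDiff ℝ 1 (phi K x x') := by
  rw [contDiff_one_iff_deriv]
  refine ⟨fun t => (phi_deriv K x x' t).differentiableAt, ?_⟩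
  have : deriv (phi K x x') = psi K x x' := funext fun t => (phi_deriv K x x' t).deriv
  rw [this]; exact psi_cont K x x'
lemma phi_bdd {K x x' : ℝ} (h : x' < x) : ∃ M, ∀ t, |phi K x x' t| ≤ M := by
  refine ⟨∫ s, ‖psi K x x' s‖, fun t => ?_⟩
  have hi : Integrable (psi K x x') := (psi_cont K x x').integrable_of_hasCompactSupport (psi_supp h)
  exact (intervalIntegral.norm_integral_le_integral_norm_uIoc).trans
    (setIntegral_le_integral hi.norm (ae_of_all _ fun _ => norm_nonneg _))
lemma phi_mono {K x x' : ℝ} (hK : 0 < K) : Monotone (phi K x x') :=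
  monotone_of_deriv_nonneg (fun t => (phi_deriv K x x' t).differentiableAt)
    fun t => by rw [(phi_deriv K x x' t).deriv]; exact psi_nonneg hK _ _ _
lemma phi_neg {K x x' t : ℝ} (ht : t ≤ 0) : phi K x x' t = 0 := by
  unfold phi
  rw [intervalIntegral.integral_congr (g := fun _ => 0)]
  · simp
  · intro s hs
    rw [Set.uIcc_of_ge ht] at hs
    exact psi_zero_neg hs.2
lemma phi_ge {K x x' t : ℝ} (hK : 0 < K) (h : x' < x) (ht : 0 ≤ t) :
    chi x x' t * (Real.exp (t ^ 2 / (2 * K)) - 1) ≤ phi K x x' t := by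
  have e : ∫ s in (0:ℝ)..t, chi x x' t * (s / K * Real.exp (s ^ 2 / (2 * K))) =
      chi x x' t * (Real.exp (t ^ 2 / (2 * K)) - 1) := by
    rw [intervalIntegral.integral_const_mul]
    congr 1
    rw [intervalIntegral.integral_eq_sub_of_hasDerivAt (f := fun s => Real.exp (s ^ 2 / (2 * K)))]
    · simp
    · intro s _
      have h1 : HasDerivAt (fun s : ℝ => s ^ 2 / (2 * K)) (s / K) s := by
        refine ((hasDerivAt_pow 2 s).div_const (2 * K)).congr_deriv ?_
        field_simp
        simp
      refine h1.exp.congr_deriv (by ring)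
    · exact Continuous.intervalIntegrable (by fun_prop) _ _
  rw [← e]
  unfold phi
  refine intervalIntegral.integral_mono_on ht (Continuous.intervalIntegrable (by fun_prop) _ _)
    ((psi_cont K x x').intervalIntegrable _ _) fun s hs => ?_
  unfold psi
  rw [max_eq_left hs.1, mul_comm]
  have := chi_anti h hs.2
  have := hs.1
  gcongr

lemma key_pt {K x x' : ℝ} (hK : 0 < K) (h : x' < x) (hx' : 0 < x') (t : ℝ) :
    Set.indicator (Set.Ici x) (fun _ => x * Real.exp (x' ^ 2 / (2 * K))) t - max t 0 ≤
      phi K x x' t * t - K * psi K x x' t := by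
  rcases le_total t 0 with ht | ht
  · rw [phi_neg ht, psi_zero_neg ht, max_eq_right ht, Set.indicator_of_notMem (by simp; linarith)]
    simp
  · rw [max_eq_left ht]
    by_cases hxt : x ≤ t
    · rw [Set.indicator_of_mem (by simpa using hxt)]
      have h1 := phi_ge hK h hx'.le
      rw [chi_one h, one_mul] at h1
      have h2 := phi_mono (x := x) (x' := x') hK (h.le.trans hxt)
      have h3 : psi K x x' t = 0 := by simp [psi, chi_zero h hxt]
      rw [h3]
      have h4 := mul_le_mul_of_nonneg_right (h1.trans h2) ht
      have h5 := mul_le_mul_of_nonneg_right hxt (Real.exp_pos (x' ^ 2 / (2 * K))).le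
      nlinarith
    · rw [Set.indicator_of_notMem (by simpa using hxt)]
      have h1 := mul_le_mul_of_nonneg_right (phi_ge hK h ht) ht
      have h2 : K * psi K x x' t = t * Real.exp (t ^ 2 / (2 * K)) * chi x x' t := by
        unfold psi; rw [max_eq_left ht]; field_simp
      rw [h2]
      have := mul_le_mul_of_nonneg_right (chi_le_one x x' t) ht
      nlinarith

lemma tail_smooth {d : ℕ} (g : EE d → ℝ) (hg : ContDiff ℝ 1 g) (L : NNReal) (hL0 : 0 < L)
    (hgl : LipschitzWith L g) (hgi : Integrable g (gam d)) (hg0 : ∫ y, g y ∂(gam d) = 0)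
    (x x' : ℝ) (hx' : 0 < x') (h : x' < x) :
    x * Real.exp (x' ^ 2 / (2 * (L : ℝ) ^ 2)) * ((gam d) {y | x ≤ g y}).toReal ≤
      ∫ y, max (g y) 0 ∂(gam d) := by
  set K : ℝ := (L : ℝ) ^ 2 with hKd
  have hK : 0 < K := by positivity
  have hL : ∀ y, ‖fderiv ℝ g y‖ ≤ L := fun y => norm_fderiv_le_of_lipschitz ℝ hgl
  obtain ⟨M, hM⟩ := phi_bdd (K := K) h
  obtain ⟨B, hB⟩ := (psi_supp (K := K) h).exists_bound_of_continuous (psi_cont K x x')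
  have hfd : ∀ y, HasFDerivAt (fun y => phi K x x' (g y)) (psi K x x' (g y) • fderiv ℝ g y) y := fun y =>
    (phi_deriv K x x' (g y)).comp_hasFDerivAt y ((hg.differentiable (by simp)) y).hasFDerivAt
  have hgc := hg.continuous
  have hpc := (phi_contDiff K x x').continuous
  have hqc := psi_cont K x x'
  have hnd : ∀ y, ‖fderiv ℝ (fun y => phi K x x' (g y)) y‖ ≤ psi K x x' (g y) * L := by
    intro y
    rw [(hfd y).fderiv, norm_smul, Real.norm_of_nonneg (psi_nonneg hK _ _ _)]
    exact mul_le_mul_of_nonneg_left (hL y) (psi_nonneg hK _ _ _)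
  have hpsi : Integrable (fun y => psi K x x' (g y)) (gam d) :=
    (integrable_const B).mono' (by fun_prop) (ae_of_all _ fun y => hB _)
  have hh : ContDiff ℝ 1 (fun y => phi K x x' (g y)) := (phi_contDiff K x x').comp hg
  have hcov := cov_bound g (fun y => phi K x x' (g y)) hg hh L M (B * L)
    hL (fun y => hM _) (fun y => (hnd y).trans (by
      gcongr; exact (le_abs_self _).trans (hB _))) hgi hg0
  have h2 : ∫ y, ‖fderiv ℝ (fun y => phi K x x' (g y)) y‖ ∂(gam d) ≤ (∫ y, psi K x x' (g y) ∂(gam d)) * L := by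
    rw [← integral_mul_const]
    refine integral_mono ((hpsi.mul_const L).mono' ?_ (ae_of_all _ fun y => ?_)) (hpsi.mul_const L) hnd
    · exact ((hh.continuous_fderiv (by simp)).norm).aestronglyMeasurable
    · simpa using hnd y
  have h3 : ∫ y, phi K x x' (g y) * g y ∂(gam d) ≤ K * ∫ y, psi K x x' (g y) ∂(gam d) := by
    refine hcov.trans ((mul_le_mul_of_nonneg_left h2 L.2).trans (le_of_eq ?_))
    rw [hKd]; change (L:ℝ) * _ = _; ring
  have iphi : Integrable (fun y => phi K x x' (g y) * g y) (gam d) := by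
    refine (hgi.norm.const_mul M).mono' (by fun_prop) (ae_of_all _ fun y => ?_)
    rw [norm_mul]; gcongr; exact hM _
  have hms : MeasurableSet {y | x ≤ g y} := measurableSet_le measurable_const hgc.measurable
  have imax : Integrable (fun y => max (g y) 0) (gam d) := hgi.pos_part
  have iind : Integrable (fun y => Set.indicator {y | x ≤ g y}
      (fun _ => x * Real.exp (x' ^ 2 / (2 * K))) y) (gam d) :=
    (integrable_const _).indicator hms
  have h4 := integral_mono (iind.sub imax) (iphi.sub (hpsi.const_mul K)) (fun y => by
    have := key_pt hK h hx' (g y)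
    simpa [Set.indicator_apply] using this)
  simp only [Pi.sub_apply] at h4
  rw [integral_sub iind imax, integral_sub iphi (hpsi.const_mul K), integral_const_mul,
    integral_indicator_const _ hms] at h4
  simp only [smul_eq_mul, Measure.real] at h4
  linarith

lemma lip_integrable {d : ℕ} (g : EE d → ℝ) (L : NNReal) (hgl : LipschitzWith L g) :
    Integrable g (gam d) := by
  have hgc := hgl.continuous
  refine ((integrable_const |g 0|).add (integrable_norm_stdG.const_mul (L : ℝ))).mono' (by fun_prop)
    (ae_of_all _ fun y => ?_)
  have := hgl.dist_le_mul y 0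
  rw [dist_zero_right, Real.dist_eq] at this
  have h2 := abs_sub_abs_le_abs_sub (g y) (g 0)
  simp only [Real.norm_eq_abs, Pi.add_apply]
  linarith

lemma mollify {d : ℕ} (g : EE d → ℝ) (L : NNReal) (hgl : LipschitzWith L g) (ε : ℝ) (hε : 0 < ε) :
    ∃ k : EE d → ℝ, ContDiff ℝ 1 k ∧ LipschitzWith L k ∧ ∀ y, |k y - g y| ≤ ε := by
  set δ := ε / (L + 1) with hδ
  have hL1 : (0:ℝ) < L + 1 := by positivity
  have hδ0 : 0 < δ := by positivity
  let φ : ContDiffBump (0 : EE d) := ⟨δ / 2, δ, by positivity, by linarith⟩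
  have hgc := hgl.continuous
  have hcs := φ.hasCompactSupport_normed (μ := (volume : Measure (EE d)))
  have hcd : ContDiff ℝ 1 (φ.normed volume) := φ.contDiff_normed
  refine ⟨MeasureTheory.convolution (φ.normed volume) g (ContinuousLinearMap.lsmul ℝ ℝ) volume, ?_, ?_, ?_⟩
  · exact hcs.contDiff_convolution_left _ hcd hgc.locallyIntegrable
  · refine LipschitzWith.of_dist_le_mul fun a b => ?_
    rw [dist_eq_norm]
    simp only [MeasureTheory.convolution, ContinuousLinearMap.lsmul_apply]
    have hi : ∀ a, Integrable (fun t => φ.normed volume t • g (a - t)) volume := fun a =>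
      Continuous.integrable_of_hasCompactSupport
        (hcd.continuous.smul (by fun_prop)) hcs.smul_right
    rw [← integral_sub (hi a) (hi b)]
    have hi2 : Integrable (fun t => φ.normed volume t * (L * dist a b)) volume :=
      (hcd.continuous.integrable_of_hasCompactSupport hcs).mul_const _
    refine (norm_integral_le_of_norm_le hi2 (ae_of_all _ fun t => ?_)).trans (le_of_eq ?_)
    · rw [← smul_sub, norm_smul, Real.norm_of_nonneg (φ.nonneg_normed _)]
      refine mul_le_mul_of_nonneg_left ?_ (φ.nonneg_normed _)
      rw [← dist_eq_norm]
      exact (hgl.dist_le_mul _ _).trans (by rw [dist_sub_right])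
    · rw [integral_mul_const, φ.integral_normed, one_mul]
  · intro y
    rw [← Real.dist_eq]
    refine φ.dist_normed_convolution_le hgc.aestronglyMeasurable fun z hz => ?_
    refine (hgl.dist_le_mul _ _).trans ?_
    have : dist z y < δ := hz
    calc (L:ℝ) * dist z y ≤ (L + 1) * δ := by gcongr; linarith
      _ = ε := by rw [hδ]; field_simp

lemma tail_lip {d : ℕ} (g : EE d → ℝ) (L : NNReal) (hL0 : 0 < L)
    (hgl : LipschitzWith L g) (hg0 : ∫ y, g y ∂(gam d) = 0) (x : ℝ) (hx : 0 < x) :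
    x * Real.exp (x ^ 2 / (2 * (L : ℝ) ^ 2)) * ((gam d) {y | x ≤ g y}).toReal ≤
      ∫ y, max (g y) 0 ∂(gam d) := by
  have hgi := lip_integrable g L hgl
  have main : ∀ ε : ℝ, 0 < ε → 3 * ε < x →
      (x - 2 * ε) * Real.exp ((x - 3 * ε) ^ 2 / (2 * (L : ℝ) ^ 2)) * ((gam d) {y | x ≤ g y}).toReal ≤
      ∫ y, max (g y) 0 ∂(gam d) + 2 * ε := by
    intro ε hε hεx
    obtain ⟨k, hk, hkl, hkg⟩ := mollify g L hgl ε hε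
    have hki := lip_integrable k L hkl
    set c := ∫ y, k y ∂(gam d) with hc
    have hcε : |c| ≤ ε := by
      have e : c = ∫ y, (k y - g y) ∂(gam d) := by rw [integral_sub hki hgi, hg0, sub_zero]
      rw [e]
      have := norm_integral_le_of_norm_le_const (μ := gam d) (f := fun y => k y - g y) (ae_of_all _ hkg)
      simpa using this
    have hck : ∀ y, |(k y - c) - g y| ≤ 2 * ε := fun y => by
      have h1 := abs_le.1 (hkg y)
      have h2 := abs_le.1 hcε
      rw [abs_le]; constructor <;> linarith
    have hk' : LipschitzWith L (fun y => k y - c) := by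
      intro a b
      simpa using hkl a b
    have hi' := lip_integrable _ L hk'
    have ht := tail_smooth (fun y => k y - c) (hk.sub contDiff_const) L hL0 hk' hi'
      (by rw [integral_sub hki (integrable_const _)]; simp [hc]) (x - 2 * ε) (x - 3 * ε)
      (by linarith) (by linarith)
    have h1 : ((gam d) {y | x ≤ g y}).toReal ≤ ((gam d) {y | x - 2 * ε ≤ k y - c}).toReal := by
      refine ENNReal.toReal_mono (measure_ne_top _ _) (measure_mono fun y hy => ?_)
      have := (abs_le.1 (hck y)).1
      simp only [Set.mem_ofPred_eq] at hy ⊢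
      linarith
    have h2 : ∫ y, max (k y - c) 0 ∂(gam d) ≤ ∫ y, max (g y) 0 ∂(gam d) + 2 * ε := by
      have : ∫ y, (max (g y) 0 + 2 * ε) ∂(gam d) = ∫ y, max (g y) 0 ∂(gam d) + 2 * ε := by
        rw [integral_add hgi.pos_part (integrable_const _)]; simp
      rw [← this]
      refine integral_mono hi'.pos_part (hgi.pos_part.add (integrable_const _)) fun y => ?_
      have h3 := (abs_le.1 (hck y)).2
      have h4 := le_max_left (g y) 0
      have h5 := le_max_right (g y) 0
      exact max_le (by linarith) (by linarith)
    refine le_trans ?_ (ht.trans h2)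
    have : 0 ≤ x - 2 * ε := by linarith
    gcongr
  have c1 : Continuous fun ε : ℝ => (x - 2 * ε) * Real.exp ((x - 3 * ε) ^ 2 / (2 * (L : ℝ) ^ 2)) *
      ((gam d) {y | x ≤ g y}).toReal := by fun_prop
  have c2 : Continuous fun ε : ℝ => ∫ y, max (g y) 0 ∂(gam d) + 2 * ε := by fun_prop
  have t1 := (c1.tendsto 0).mono_left (nhdsWithin_le_nhds (s := Set.Ioi 0))
  have t2 := (c2.tendsto 0).mono_left (nhdsWithin_le_nhds (s := Set.Ioi 0))
  have := le_of_tendsto_of_tendsto t1 t2 (by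
    filter_upwards [Ioo_mem_nhdsGT (show (0:ℝ) < x / 3 by positivity)] with ε hε
    exact main ε hε.1 (by linarith [hε.2]))
  simpa using this


open scoped MatrixOrder
lemma lip_dir {d : ℕ} (f : EE d → ℝ) (C : NNReal) (hf : LipschitzWith C f) (v : EE d) (c : ℝ)
    (hc : ∀ z, DifferentiableAt ℝ f z → fderiv ℝ f z v ≤ c) (y : EE d) :
    f (y + v) - f y ≤ c := by
  have hfc := hf.continuous
  have hD : ∀ᵐ z : EE d, DifferentiableAt ℝ f z := hf.ae_differentiableAt
  have hms : MeasurableSet {z : EE d | DifferentiableAt ℝ f z} := measurableSet_of_differentiableAt ℝ f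
  have h1 : ∀ᵐ y : EE d, ∀ᵐ t : ℝ, DifferentiableAt ℝ f (y + t • v) := by
    rw [Measure.ae_ae_comm (p := fun (y : EE d) (t : ℝ) => DifferentiableAt ℝ f (y + t • v))]
    · refine ae_of_all _ fun t => ?_
      exact (measurePreserving_add_right volume (t • v)).quasiMeasurePreserving.ae hD
    · exact hms.preimage (f := fun p : EE d × ℝ => p.1 + p.2 • v)
        (Continuous.measurable (by fun_prop))
  have h2 : ∀ᵐ y : EE d, f (y + v) - f y ≤ c := by
    filter_upwards [h1] with y hy
    have hl : LipschitzWith (C * ‖v‖₊) (fun t : ℝ => f (y + t • v)) := by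
      refine hf.comp (LipschitzWith.of_dist_le_mul fun a b => ?_)
      rw [dist_add_left, dist_eq_norm, ← sub_smul, norm_smul, mul_comm, dist_eq_norm, coe_nnnorm]
    have hac : AbsolutelyContinuousOnInterval (fun t : ℝ => f (y + t • v)) 0 1 :=
      hl.lipschitzOnWith.absolutelyContinuousOnInterval
    have e := hac.integral_deriv_eq_sub
    simp only [one_smul, zero_smul, add_zero] at e
    rw [← e]
    have : c = ∫ t in (0:ℝ)..1, c := by simp
    rw [this]
    refine intervalIntegral.integral_mono_ae (by norm_num) hac.intervalIntegrable_deriv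
      (by simp) ?_
    filter_upwards [hy] with t ht
    have hd : HasDerivAt (fun t : ℝ => y + t • v) v t := by
      simpa using ((hasDerivAt_id t).smul_const v).const_add y
    have := ht.hasFDerivAt.comp_hasDerivAt t hd
    have e2 : deriv (fun t : ℝ => f (y + t • v)) t = fderiv ℝ f (y + t • v) v := this.deriv
    rw [e2]
    exact hc _ ht
  have hcl : IsClosed {y : EE d | f (y + v) - f y ≤ c} :=
    isClosed_le (by fun_prop) continuous_const
  have hdense : Dense {y : EE d | f (y + v) - f y ≤ c} := Measure.dense_of_ae h2
  have := hdense.closure_eq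
  rw [hcl.closure_eq] at this
  exact Set.eq_univ_iff_forall.1 this y

lemma quad_eq {d : ℕ} (S : Matrix (Fin d) (Fin d) ℝ) (a : EE d) :
    (a.ofLp ⬝ᵥ S.mulVec a.ofLp) = ∑ i, ∑ j, S i j * a i * a j := by
  simp only [dotProduct, Matrix.mulVec, Finset.mul_sum]
  refine Finset.sum_congr rfl fun i _ => Finset.sum_congr rfl fun j _ => ?_
  ring

lemma sqrt_norm {d : ℕ} (S : Matrix (Fin d) (Fin d) ℝ) (hpsd : S.PosSemidef) (a b : EE d) :
    inner ℝ a (Matrix.toEuclideanCLM (𝕜 := ℝ) (CFC.sqrt S) b) ≤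
      Real.sqrt (∑ i, ∑ j, S i j * a i * a j) * ‖b‖ := by
  have hsa : IsSelfAdjoint (Matrix.toEuclideanCLM (𝕜 := ℝ) (CFC.sqrt S)) :=
    IsSelfAdjoint.map (CFC.sqrt_nonneg S).isSelfAdjoint _
  set A := Matrix.toEuclideanCLM (𝕜 := ℝ) (CFC.sqrt S) with hA
  have h1 : ∀ b, inner ℝ a (A b) = inner ℝ (A a) b := by
    intro b
    rw [← ContinuousLinearMap.adjoint_inner_left, hsa.adjoint_eq]
  have h2 : ‖A a‖ = Real.sqrt (∑ i, ∑ j, S i j * a i * a j) := by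
    rw [← quad_eq, ← Matrix.inner_toEuclideanCLM, ← CFC.sqrt_mul_sqrt_self S (Matrix.nonneg_iff_posSemidef.2 hpsd), map_mul, ContinuousLinearMap.mul_def, ContinuousLinearMap.comp_apply, ← hA, h1, real_inner_self_eq_norm_sq, Real.sqrt_sq (norm_nonneg _)]
  rw [h1, ← h2]
  exact real_inner_le_norm _ _

lemma P_eq {d : ℕ} (P : Measure (EE d)) (m : EE d) (S : Matrix (Fin d) (Fin d) ℝ)
    (hP : IsGaussianMeasure P m S) (hpsd : S.PosSemidef) : P = multivariateGaussian m S := by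
  have := hP.1
  apply Measure.ext_of_charFun
  ext t
  rw [charFun_multivariateGaussian hpsd, charFun_apply]
  have h := hP.2 t
  have e : ∀ x : EE d, inner ℝ x t = ∑ i, t i * x i := fun x => by
    simp [PiLp.inner_apply]
  have e2 : inner ℝ t m = ∑ i, m i * t i := by
    simp [PiLp.inner_apply]
  rw [quad_eq, e2]
  simp_rw [e]
  simp_rw [mul_comm Complex.I] at h
  exact h


lemma main18 {d : ℕ} (P : Measure (EuclideanSpace ℝ (Fin d)))
    (m : EuclideanSpace ℝ (Fin d)) (S : Matrix (Fin d) (Fin d) ℝ)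
    (hP : IsGaussianMeasure P m S) (hS : S.IsSymm) (hpsd : S.PosSemidef)
    (f : EuclideanSpace ℝ (Fin d) → ℝ) (C : NNReal) (hf : LipschitzWith C f)
    (hmean : ∫ y, f y ∂P = 0) (K : ℝ) (hK : 0 < K)
    (hgrad : ∀ y, DifferentiableAt ℝ f y →
      ∑ i, ∑ j, S i j * gradient f y i * gradient f y j ≤ K)
    (x : ℝ) (hx : 0 < x) :
    (P {y | x ≤ f y}).toReal ≤
      ((∫ y, max (f y) 0 ∂P) / x) * Real.exp (-x ^ 2 / (2 * K)) := by
  have hfc := hf.continuous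
  set A := Matrix.toEuclideanCLM (𝕜 := ℝ) (CFC.sqrt S) with hA
  have hPe : P = (gam d).map (fun z => m + A z) := P_eq P m S hP hpsd
  have hTm : Continuous (fun z : EE d => m + A z) := by fun_prop
  set g : EE d → ℝ := fun z => f (m + A z) with hg
  set L : NNReal := ⟨Real.sqrt K, Real.sqrt_nonneg K⟩ with hLdef
  have hLK : (L : ℝ) = Real.sqrt K := rfl
  have hL0 : 0 < L := by
    rw [← NNReal.coe_pos, hLK]; exact Real.sqrt_pos.2 hK
  have hstep : ∀ a b : EE d, g a - g b ≤ Real.sqrt K * ‖a - b‖ := by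
    intro a b
    have := lip_dir f C hf (A (a - b)) (Real.sqrt K * ‖a - b‖) (fun z hz => ?_) (m + A b)
    · have e : m + A b + A (a - b) = m + A a := by rw [map_sub]; abel
      rw [e] at this
      exact this
    · have e : fderiv ℝ f z (A (a - b)) = inner ℝ (gradient f z) (A (a - b)) := by
        rw [gradient, InnerProductSpace.toDual_symm_apply]
      rw [e]
      refine (sqrt_norm S hpsd _ _).trans ?_
      gcongr
      exact hgrad z hz
  have hgl : LipschitzWith L g := by
    refine LipschitzWith.of_dist_le_mul fun a b => ?_
    rw [Real.dist_eq, dist_eq_norm, hLK, abs_le]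
    have h1 := hstep a b
    have h2 := hstep b a
    rw [norm_sub_rev] at h2
    constructor <;> linarith
  have hg0 : ∫ y, g y ∂(gam d) = 0 := by
    rw [hPe, integral_map hTm.aemeasurable hfc.aestronglyMeasurable] at hmean
    exact hmean
  have hms : MeasurableSet {y | x ≤ f y} := measurableSet_le measurable_const hfc.measurable
  have e1 : P {y | x ≤ f y} = gam d {z | x ≤ g z} := by
    rw [hPe, Measure.map_apply hTm.measurable hms]; rfl
  have e2 : ∫ y, max (f y) 0 ∂P = ∫ z, max (g z) 0 ∂(gam d) := by
    rw [hPe, integral_map hTm.aemeasurable (hfc.max continuous_const).aestronglyMeasurable]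
  have h := tail_lip g L hL0 hgl hg0 x hx
  rw [hLK, Real.sq_sqrt hK.le] at h
  rw [e1, e2, neg_div, Real.exp_neg, ← div_eq_mul_inv, div_div, le_div_iff₀ (by positivity)]
  linarith


end helpers

/-- Refined Gaussian concentration:
`P(f(X) ≥ x) ≤ (E f(X)⁺ / x) exp(-x²/(2‖Σ^{1/2}∇f‖²_∞))` for `x > 0`. -/
theorem stmt18 {d : ℕ} (P : Measure (EuclideanSpace ℝ (Fin d)))
    (m : EuclideanSpace ℝ (Fin d)) (S : Matrix (Fin d) (Fin d) ℝ)
    (hP : IsGaussianMeasure P m S) (hS : S.IsSymm) (hpsd : S.PosSemidef)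
    (f : EuclideanSpace ℝ (Fin d) → ℝ) (C : NNReal) (hf : LipschitzWith C f)
    (hmean : ∫ y, f y ∂P = 0) (K : ℝ) (hK : 0 < K)
    (hgrad : ∀ y, DifferentiableAt ℝ f y →
      ∑ i, ∑ j, S i j * gradient f y i * gradient f y j ≤ K)
    (x : ℝ) (hx : 0 < x) :
    (P {y | x ≤ f y}).toReal ≤
      ((∫ y, max (f y) 0 ∂P) / x) * Real.exp (-x ^ 2 / (2 * K)) :=
  main18 P m S hP hS hpsd f C hf hmean K hK hgrad x hx
end

section
/- If X ~ N(μ, Σ) and f : ℝ^d → ℝ is Lipschitz with E f(X) = 0 and ‖Σ^{1/2}∇f‖_∞ = L < ∞, then E[f(X)⁺] ≤ (√π/(2√2)) L. -/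
open MeasureTheory Finset

open ProbabilityTheory Filter Topology

lemma aux_pi_ac (μ ν : Measure ℝ) [SigmaFinite μ] [SigmaFinite ν] (h : μ ≪ ν) (n : ℕ) :
    Measure.pi (fun _ : Fin n => μ) ≪ Measure.pi (fun _ : Fin n => ν) := by
  induction n with
  | zero =>
    rw [Measure.pi_of_empty, Measure.pi_of_empty]
  | succ n ih =>
    have h1 := (measurePreserving_piFinSuccAbove (fun _ : Fin (n+1) => μ) 0).symm
    have h2 := (measurePreserving_piFinSuccAbove (fun _ : Fin (n+1) => ν) 0).symm
    rw [← h1.map_eq, ← h2.map_eq]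
    exact (h.prod ih).map h1.measurable

lemma aux_std_ac (d : ℕ) :
    stdGaussian (EuclideanSpace ℝ (Fin d)) ≪ (volume : Measure (EuclideanSpace ℝ (Fin d))) := by
  rw [← map_pi_eq_stdGaussian, ← (PiLp.volume_preserving_toLp (Fin d)).map_eq]
  exact (aux_pi_ac _ _ (gaussianReal_absolutelyContinuous 0 one_ne_zero) d).map (by fun_prop)

lemma aux_abs_gauss : ∫ x, |x| ∂(gaussianReal 0 1) = Real.sqrt (2 / Real.pi) := by
  rw [integral_gaussianReal_eq_integral_smul one_ne_zero]
  have h1 : (fun x : ℝ => gaussianPDFReal 0 1 x • |x|) =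
      fun x => (fun y => gaussianPDFReal 0 1 y * y) |x| := by
    ext x
    simp [gaussianPDFReal]
  rw [h1, integral_comp_abs (f := fun y => gaussianPDFReal 0 1 y * y)]
  have h2 : ∀ y : ℝ, gaussianPDFReal 0 1 y * y =
      (Real.sqrt (2 * Real.pi))⁻¹ * (y ^ (1:ℝ) * Real.exp (-(1/2) * y ^ (2:ℝ))) := by
    intro y
    simp only [gaussianPDFReal, NNReal.coe_one, mul_one, sub_zero, Real.rpow_one, Real.rpow_two]
    rw [show -y^2/2 = -(1/2) * y^2 by ring]; ring
  simp_rw [h2]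
  rw [integral_const_mul, integral_rpow_mul_exp_neg_mul_rpow (by norm_num) (by norm_num) (by norm_num)]
  norm_num
  have : (0:ℝ) < √Real.pi := by positivity
  have : (0:ℝ) < √2 := by positivity
  field_simp
  norm_num

lemma aux_dual {E : Type*} [NormedAddCommGroup E] [InnerProductSpace ℝ E] [FiniteDimensional ℝ E]
    [MeasurableSpace E] [BorelSpace E] (l : StrongDual ℝ E) :
    ∫ y, |l y| ∂(stdGaussian E) = ‖l‖ * Real.sqrt (2 / Real.pi) := by
  have h := IsGaussian.map_eq_gaussianReal (μ := stdGaussian E) l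
  rw [integral_strongDual_stdGaussian, variance_dual_stdGaussian] at h
  have h3 := gaussianReal_map_const_mul (μ := 0) (v := 1) ‖l‖
  have h4 : (stdGaussian E).map l = (gaussianReal 0 1).map (‖l‖ * ·) := by
    rw [h, h3]; congr 1
    · simp
    · ext; simp
  have h5 : ∫ y, |l y| ∂(stdGaussian E) = ∫ x, |x| ∂((stdGaussian E).map l) := by
    rw [integral_map (by fun_prop) (by fun_prop)]
  rw [h5, h4, integral_map (by fun_prop) (by fun_prop)]
  simp_rw [abs_mul, abs_norm]
  rw [integral_const_mul, aux_abs_gauss]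

lemma aux_lip {d : ℕ} (f : EuclideanSpace ℝ (Fin d) → ℝ) (C : NNReal) (hf : LipschitzWith C f)
    (v : EuclideanSpace ℝ (Fin d)) (M : ℝ)
    (hM : ∀ y, DifferentiableAt ℝ f y → |fderiv ℝ f y v| ≤ M) (x : EuclideanSpace ℝ (Fin d)) :
    |f (x + v) - f x| ≤ M := by
  set γ := stdGaussian (EuclideanSpace ℝ (Fin d)) with hγ
  have hint : Integrable (fun z : EuclideanSpace ℝ (Fin d) => ‖z‖) γ :=
    (IsGaussian.integrable_id (μ := γ)).norm
  have hfc := hf.continuous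
  have hintf : ∀ (y : EuclideanSpace ℝ (Fin d)) (ε : ℝ), Integrable (fun z => f (y + ε • z)) γ := by
    intro y ε
    have : Integrable (fun z => |f y| + C * (|ε| * ‖z‖)) γ :=
      (integrable_const _).add ((hint.const_mul _).const_mul _)
    refine this.mono' (by fun_prop) (ae_of_all _ fun z => ?_)
    have := hf.dist_le_mul (y + ε • z) y
    rw [Real.dist_eq, dist_eq_norm, add_sub_cancel_left, norm_smul, Real.norm_eq_abs] at this
    have h2 := abs_sub_abs_le_abs_sub (f (y + ε • z)) (f y)
    rw [Real.norm_eq_abs]; linarith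
  have key : ∀ ε : ℝ, ε ≠ 0 →
      |(∫ z, f (x + v + ε • z) ∂γ) - ∫ z, f (x + ε • z) ∂γ| ≤ M := by
    intro ε hε
    have hdiff : ∀ t : ℝ, ∀ᵐ z ∂γ, DifferentiableAt ℝ f (x + t • v + ε • z) := by
      intro t
      apply aux_std_ac d
      have h0 := hf.ae_differentiableAt (μ := (volume : Measure (EuclideanSpace ℝ (Fin d))))
      have h1 : Measure.QuasiMeasurePreserving (fun z : EuclideanSpace ℝ (Fin d) => x + t • v + ε • z) := by
        refine ⟨by fun_prop, ?_⟩
        have : (fun z : EuclideanSpace ℝ (Fin d) => x + t • v + ε • z) =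
            (fun z => x + t • v + z) ∘ (fun z => ε • z) := rfl
        rw [this, ← Measure.map_map (by fun_prop) (by fun_prop), Measure.map_addHaar_smul _ hε,
          Measure.map_smul, map_add_left_eq_self]
        exact Measure.smul_absolutelyContinuous
      exact h1.ae h0
    have hder : ∀ t : ℝ, HasDerivAt (fun t : ℝ => ∫ z, f (x + t • v + ε • z) ∂γ)
        (∫ z, fderiv ℝ f (x + t • v + ε • z) v ∂γ) t := by
      intro t
      refine (hasDerivAt_integral_of_dominated_loc_of_lip (s := Set.univ) (bound := fun _ => C * ‖v‖)
        (F := fun (t:ℝ) z => f (x + t • v + ε • z)) univ_mem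
        (Eventually.of_forall fun t => by fun_prop) (hintf _ _) ?_ ?_ (integrable_const _) ?_).2
      · have := measurable_fderiv_apply_const ℝ f v
        exact (this.comp (by fun_prop : Measurable fun z => x + t • v + ε • z)).aestronglyMeasurable
      · refine ae_of_all _ fun z => LipschitzOnWith.of_dist_le_mul fun a _ b _ => ?_
        have := hf.dist_le_mul (x + a • v + ε • z) (x + b • v + ε • z)
        refine this.trans (le_of_eq ?_)
        rw [dist_eq_norm, Real.dist_eq, show x + a • v + ε • z - (x + b • v + ε • z) = (a - b) • v by module,
          norm_smul, Real.norm_eq_abs, Real.coe_nnabs, abs_of_nonneg (by positivity : 0 ≤ C * ‖v‖)]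
        ring
      · filter_upwards [hdiff t] with z hz
        have h1 : HasDerivAt (fun t : ℝ => x + t • v + ε • z) v t := by
          simpa using (((hasDerivAt_id t).smul_const v).const_add x).add_const (ε • z)
        exact hz.hasFDerivAt.comp_hasDerivAt t h1
    have hbd : ∀ t : ℝ, ‖∫ z, fderiv ℝ f (x + t • v + ε • z) v ∂γ‖ ≤ M := by
      intro t
      have := norm_integral_le_of_norm_le_const (μ := γ)
        (f := fun z => fderiv ℝ f (x + t • v + ε • z) v) ((hdiff t).mono fun z hz => hM _ hz)
      simpa using this
    have := Convex.norm_image_sub_le_of_norm_hasDerivWithin_le (s := Set.univ)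
      (fun t _ => (hder t).hasDerivWithinAt) (fun t _ => hbd t) convex_univ
      (Set.mem_univ 0) (Set.mem_univ 1)
    simpa using this
  have hlim : ∀ y, Tendsto (fun n : ℕ => ∫ z, f (y + (1 / ((n:ℝ) + 1)) • z) ∂γ) atTop (𝓝 (f y)) := by
    intro y
    have h1 : f y = ∫ z, f y ∂γ := by simp
    rw [h1]
    refine tendsto_integral_of_dominated_convergence (fun z => |f y| + C * ‖z‖) (fun n => by fun_prop)
      ((integrable_const _).add (hint.const_mul _)) ?_ ?_
    · intro n
      refine ae_of_all _ fun z => ?_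
      have := hf.dist_le_mul (y + (1 / ((n:ℝ) + 1)) • z) y
      rw [Real.dist_eq, dist_eq_norm, add_sub_cancel_left, norm_smul, Real.norm_eq_abs] at this
      have h2 := abs_sub_abs_le_abs_sub (f (y + (1 / ((n:ℝ) + 1)) • z)) (f y)
      have h3 : |1 / ((n:ℝ) + 1)| ≤ 1 := by
        rw [abs_of_nonneg (by positivity), div_le_one (by positivity)]; linarith [n.cast_nonneg (α := ℝ)]
      have h4 : C * (|1 / ((n:ℝ) + 1)| * ‖z‖) ≤ C * ‖z‖ := by
        gcongr; nlinarith [norm_nonneg z]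
      rw [Real.norm_eq_abs]; linarith
    · refine ae_of_all _ fun z => ?_
      have h5 : Tendsto (fun n : ℕ => y + (1 / ((n:ℝ) + 1)) • z) atTop (𝓝 (y + (0:ℝ) • z)) :=
        (tendsto_one_div_add_atTop_nhds_zero_nat.smul_const z).const_add y
      rw [zero_smul, add_zero] at h5
      exact (hfc.tendsto y).comp h5
  exact le_of_tendsto ((hlim (x + v)).sub (hlim x)).abs
    (Eventually.of_forall fun n => key _ (by positivity))

lemma aux_pisier {d : ℕ} (g : EuclideanSpace ℝ (Fin d) → ℝ) (K : NNReal) (hg : LipschitzWith K g) :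
    ∫ p, |g p.1 - g p.2| ∂((stdGaussian (EuclideanSpace ℝ (Fin d))).prod
      (stdGaussian (EuclideanSpace ℝ (Fin d)))) ≤
      Real.pi / 2 * (K * Real.sqrt (2 / Real.pi)) := by
  set γ := stdGaussian (EuclideanSpace ℝ (Fin d)) with hγ
  have hint : Integrable (fun z : EuclideanSpace ℝ (Fin d) => ‖z‖) γ :=
    (IsGaussian.integrable_id (μ := γ)).norm
  have hi1 : Integrable (fun p : EuclideanSpace ℝ (Fin d) × EuclideanSpace ℝ (Fin d) => ‖p.1‖)
    (γ.prod γ) := hint.comp_fst γ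
  have hi2 : Integrable (fun p : EuclideanSpace ℝ (Fin d) × EuclideanSpace ℝ (Fin d) => ‖p.2‖)
    (γ.prod γ) := hint.comp_snd γ
  have hgc := hg.continuous
  let h : ℝ → EuclideanSpace ℝ (Fin d) × EuclideanSpace ℝ (Fin d) → ℝ :=
    fun θ p => g (Real.cos θ • p.1 + Real.sin θ • p.2)
  have hc : ∀ θ, Continuous (h θ) := fun θ => by
    simp only [h]; fun_prop
  have hhint : ∀ a b, Integrable (fun p => |h a p - h b p|) (γ.prod γ) := by
    intro a b
    have hb : Integrable (fun p : EuclideanSpace ℝ (Fin d) × EuclideanSpace ℝ (Fin d) =>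
        K * (2 * ‖p.1‖ + 2 * ‖p.2‖)) (γ.prod γ) :=
      ((hi1.const_mul 2).add (hi2.const_mul 2)).const_mul _
    refine hb.mono' (((hc a).sub (hc b)).abs.aestronglyMeasurable) (ae_of_all _ fun p => ?_)
    rw [Real.norm_eq_abs, abs_abs]
    have h1 := hg.dist_le_mul (Real.cos a • p.1 + Real.sin a • p.2)
      (Real.cos b • p.1 + Real.sin b • p.2)
    rw [Real.dist_eq, dist_eq_norm] at h1
    refine h1.trans ?_
    gcongr
    have : ∀ c, ‖Real.cos c • p.1 + Real.sin c • p.2‖ ≤ ‖p.1‖ + ‖p.2‖ := by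
      intro c
      refine (norm_add_le _ _).trans ?_
      rw [norm_smul, norm_smul, Real.norm_eq_abs, Real.norm_eq_abs]
      nlinarith [Real.abs_cos_le_one c, Real.abs_sin_le_one c, norm_nonneg p.1, norm_nonneg p.2]
    refine (norm_sub_le _ _).trans ?_
    linarith [this a, this b]
  have hrot : ∀ θ δ, ∫ p, |h (θ + δ) p - h θ p| ∂(γ.prod γ) =
      ∫ p, |h δ p - h 0 p| ∂(γ.prod γ) := by
    intro θ δ
    have hr := IsGaussian.map_rotation_eq_self (μ := γ) (by simp [hγ]) θ
    conv_rhs => rw [← hr]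
    have hcc : Continuous (fun p => |h δ p - h 0 p|) := ((hc δ).sub (hc 0)).abs
    rw [integral_map (by fun_prop) hcc.aestronglyMeasurable]
    refine integral_congr_ae (ae_of_all _ fun p => ?_)
    simp only [h, ContinuousLinearMap.rotation_apply, Real.cos_zero, Real.sin_zero, Real.cos_add,
      Real.sin_add]
    congr 2
    · congr 1; module
    · congr 1; module
  have hstep : ∀ (n : ℕ) (δ : ℝ), ∫ p, |h (n * δ) p - h 0 p| ∂(γ.prod γ) ≤
      n * ∫ p, |h δ p - h 0 p| ∂(γ.prod γ) := by
    intro n δ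
    induction n with
    | zero => simp
    | succ n ih =>
      have h1 : ∫ p, |h ((n+1 : ℕ) * δ) p - h 0 p| ∂(γ.prod γ) ≤
          ∫ p, (|h (n * δ + δ) p - h (n * δ) p| + |h (n * δ) p - h 0 p|) ∂(γ.prod γ) := by
        refine integral_mono (hhint _ _) ((hhint _ _).add (hhint _ _)) fun p => ?_
        have : ((n+1 : ℕ) : ℝ) * δ = n * δ + δ := by push_cast; ring
        simp only [this]
        exact abs_sub_le _ _ _
      rw [integral_add (hhint _ _) (hhint _ _), hrot] at h1
      push_cast at h1 ⊢
      linarith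
  let δ : ℕ → ℝ := fun n => Real.pi / 2 * (1 / ((n:ℝ) + 1))
  have hδpos : ∀ n, 0 < δ n := fun n => by
    have := Real.pi_pos
    simp only [δ]; positivity
  have hδn : ∀ n : ℕ, ((n + 1 : ℕ) : ℝ) * δ n = Real.pi / 2 := fun n => by
    simp only [δ]; push_cast; field_simp
  have hδlim : Tendsto δ atTop (𝓝[≠] 0) := by
    rw [tendsto_nhdsWithin_iff]
    refine ⟨?_, Eventually.of_forall fun n => (hδpos n).ne'⟩
    have h7 := (tendsto_one_div_add_atTop_nhds_zero_nat (𝕜 := ℝ)).const_mul (Real.pi / 2)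
    rw [mul_zero] at h7
    exact h7
  have hae : ∀ᵐ p ∂(γ.prod γ), DifferentiableAt ℝ g p.1 := by
    have : ∀ᵐ x ∂γ, DifferentiableAt ℝ g x := (aux_std_ac d) hg.ae_differentiableAt
    exact Measure.quasiMeasurePreserving_fst.ae this
  have hlim : Tendsto (fun n : ℕ => ∫ p, ((n + 1 : ℕ) : ℝ) * |h (δ n) p - h 0 p| ∂(γ.prod γ)) atTop
      (𝓝 (∫ p, Real.pi / 2 * |fderiv ℝ g p.1 p.2| ∂(γ.prod γ))) := by
    refine tendsto_integral_of_dominated_convergence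
      (fun p => Real.pi / 2 * (K * (‖p.1‖ + ‖p.2‖)))
      (fun n => (((hc (δ n)).sub (hc 0)).abs.aestronglyMeasurable).const_mul _)
      (((hi1.add hi2).const_mul _).const_mul _) ?_ ?_
    · intro n
      refine ae_of_all _ fun p => ?_
      have h1 := hg.dist_le_mul (Real.cos (δ n) • p.1 + Real.sin (δ n) • p.2)
        (Real.cos 0 • p.1 + Real.sin 0 • p.2)
      rw [Real.dist_eq, dist_eq_norm] at h1
      have h2 : ‖Real.cos (δ n) • p.1 + Real.sin (δ n) • p.2 - (Real.cos 0 • p.1 + Real.sin 0 • p.2)‖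
          ≤ δ n * (‖p.1‖ + ‖p.2‖) := by
        have e : Real.cos (δ n) • p.1 + Real.sin (δ n) • p.2 - (Real.cos 0 • p.1 + Real.sin 0 • p.2)
          = (Real.cos (δ n) - 1) • p.1 + Real.sin (δ n) • p.2 := by
          rw [Real.cos_zero, Real.sin_zero]; module
        rw [e]
        refine (norm_add_le _ _).trans ?_
        rw [norm_smul, norm_smul, Real.norm_eq_abs, Real.norm_eq_abs]
        have h3 : |Real.sin (δ n)| ≤ δ n :=
          Real.abs_sin_le_abs.trans (abs_of_pos (hδpos n)).le
        have h4 : |Real.cos (δ n) - 1| ≤ δ n := by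
          have h5 := Real.one_sub_sq_div_two_le_cos (x := δ n)
          have h6 : δ n ≤ 2 := by
            have h7 : 1 / ((n:ℝ) + 1) ≤ 1 := by
              rw [div_le_one (by positivity)]; linarith [n.cast_nonneg (α := ℝ)]
            have := Real.pi_pos
            have := Real.pi_le_four
            simp only [δ]
            nlinarith
          rw [abs_sub_comm, abs_of_nonneg (by linarith [Real.cos_le_one (δ n)])]
          nlinarith [hδpos n]
        nlinarith [norm_nonneg p.1, norm_nonneg p.2]
      rw [Real.norm_eq_abs, abs_mul, abs_abs, ← hδn n, abs_of_nonneg (by positivity)]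
      calc ((n + 1 : ℕ) : ℝ) * |h (δ n) p - h 0 p|
          ≤ ((n + 1 : ℕ) : ℝ) * (K * (δ n * (‖p.1‖ + ‖p.2‖))) := by
            gcongr
            exact h1.trans (by gcongr)
        _ = _ := by ring
    · filter_upwards [hae] with p hp
      have hd : HasDerivAt (fun t : ℝ => h t p) (fderiv ℝ g p.1 p.2) 0 := by
        have h1 : HasDerivAt (fun t : ℝ => Real.cos t • p.1 + Real.sin t • p.2) p.2 0 := by
          have := ((Real.hasDerivAt_cos 0).smul_const p.1).add ((Real.hasDerivAt_sin 0).smul_const p.2)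
          have e : -Real.sin 0 • p.1 + Real.cos 0 • p.2 = p.2 := by simp
          rw [e] at this
          exact this
        have h2 : HasFDerivAt g (fderiv ℝ g p.1) (Real.cos 0 • p.1 + Real.sin 0 • p.2) := by
          simpa using hp.hasFDerivAt
        exact h2.comp_hasDerivAt 0 h1
      rw [hasDerivAt_iff_tendsto_slope_zero] at hd
      have h3 := ((hd.comp hδlim).abs).const_mul (Real.pi / 2)
      refine h3.congr fun n => ?_
      simp only [Function.comp, zero_add, smul_eq_mul, abs_mul, abs_inv]
      rw [← hδn n, abs_of_pos (hδpos n)]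
      have := (hδpos n).ne'
      field_simp
  have hfin : ∫ p, Real.pi / 2 * |fderiv ℝ g p.1 p.2| ∂(γ.prod γ) ≤
      Real.pi / 2 * (K * Real.sqrt (2 / Real.pi)) := by
    rw [integral_const_mul]
    have hpi := Real.pi_pos
    gcongr
    have hm : Measurable (fun p : EuclideanSpace ℝ (Fin d) × EuclideanSpace ℝ (Fin d) =>
        |fderiv ℝ g p.1 p.2|) := by
      have h1 : Measurable (fun p : EuclideanSpace ℝ (Fin d) × EuclideanSpace ℝ (Fin d) =>
        fderiv ℝ g p.1) := (measurable_fderiv ℝ g).comp measurable_fst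
      have h2 : Measurable (fun p : EuclideanSpace ℝ (Fin d) × EuclideanSpace ℝ (Fin d) =>
        fderiv ℝ g p.1 p.2) :=
        (isBoundedBilinearMap_apply (𝕜 := ℝ)
          (E := EuclideanSpace ℝ (Fin d)) (F := ℝ)).continuous.measurable.comp
          (h1.prodMk measurable_snd)
      exact h2.norm
    have hI : Integrable (fun p : EuclideanSpace ℝ (Fin d) × EuclideanSpace ℝ (Fin d) =>
        |fderiv ℝ g p.1 p.2|) (γ.prod γ) := by
      refine (hi2.const_mul K).mono' hm.aestronglyMeasurable (ae_of_all _ fun p => ?_)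
      rw [Real.norm_eq_abs, abs_abs]
      exact (ContinuousLinearMap.le_opNorm _ _).trans
        (mul_le_mul_of_nonneg_right (norm_fderiv_le_of_lipschitz ℝ hg) (norm_nonneg _))
    rw [integral_prod _ hI]
    have hle : ∀ x, ∫ y, |fderiv ℝ g x y| ∂γ ≤ K * Real.sqrt (2 / Real.pi) := by
      intro x
      rw [hγ, aux_dual]
      gcongr
      exact norm_fderiv_le_of_lipschitz ℝ hg
    calc _ ≤ ∫ x, K * Real.sqrt (2 / Real.pi) ∂γ :=
          integral_mono hI.integral_prod_left (integrable_const _) hle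
      _ = _ := by simp
  refine le_trans (ge_of_tendsto hlim (Eventually.of_forall fun n => ?_)) hfin
  rw [integral_const_mul]
  have h1 := hstep (n+1) (δ n)
  rw [hδn] at h1
  refine le_trans (le_of_eq ?_) h1
  refine integral_congr_ae (ae_of_all _ fun p => ?_)
  simp [h, abs_sub_comm]

lemma aux_main {d : ℕ} (g : EuclideanSpace ℝ (Fin d) → ℝ) (K : NNReal) (hg : LipschitzWith K g)
    (h0 : ∫ x, g x ∂(stdGaussian (EuclideanSpace ℝ (Fin d))) = 0) :
    ∫ x, max (g x) 0 ∂(stdGaussian (EuclideanSpace ℝ (Fin d))) ≤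
      (Real.sqrt Real.pi / (2 * Real.sqrt 2)) * K := by
  have hP := aux_pisier g K hg
  set γ := stdGaussian (EuclideanSpace ℝ (Fin d)) with hγ
  have hgc := hg.continuous
  have hgi : Integrable g γ := by
    have hint : Integrable (fun z : EuclideanSpace ℝ (Fin d) => ‖z‖) γ :=
      (IsGaussian.integrable_id (μ := γ)).norm
    refine ((integrable_const |g 0|).add (hint.const_mul K)).mono' (by fun_prop)
      (ae_of_all _ fun z => ?_)
    have := hg.dist_le_mul z 0
    rw [Real.dist_eq, dist_zero_right] at this
    have h2 := abs_sub_abs_le_abs_sub (g z) (g 0)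
    simp only [Pi.add_apply]
    rw [Real.norm_eq_abs]; linarith
  have hpi : Integrable (fun p : EuclideanSpace ℝ (Fin d) × EuclideanSpace ℝ (Fin d) =>
      |g p.1 - g p.2|) (γ.prod γ) := ((hgi.comp_fst γ).sub (hgi.comp_snd γ)).abs
  have h1 : ∫ x, |g x| ∂γ ≤ ∫ p, |g p.1 - g p.2| ∂(γ.prod γ) := by
    rw [integral_prod _ hpi]
    refine integral_mono hgi.abs hpi.integral_prod_left fun x => ?_
    have h2 : g x = ∫ y, (g x - g y) ∂γ := by
      rw [integral_sub (integrable_const _) hgi, h0]; simp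
    calc |g x| = |∫ y, (g x - g y) ∂γ| := by rw [← h2]
      _ ≤ _ := abs_integral_le_integral_abs
  have h3 : ∫ x, max (g x) 0 ∂γ = (∫ x, |g x| ∂γ) / 2 := by
    have : ∀ x, max (g x) 0 = (1/2) * (|g x| + g x) := by
      intro x
      rcases le_total 0 (g x) with h | h
      · rw [max_eq_left h, abs_of_nonneg h]; ring
      · rw [max_eq_right h, abs_of_nonpos h]; ring
    simp_rw [this]
    rw [integral_const_mul, integral_add hgi.abs hgi, h0]; ring
  have h4 : Real.pi / 2 * (K * Real.sqrt (2 / Real.pi)) / 2 =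
      (Real.sqrt Real.pi / (2 * Real.sqrt 2)) * K := by
    rw [Real.sqrt_div (by norm_num)]
    have a : (0:ℝ) < √Real.pi := by positivity
    have b : (0:ℝ) < √2 := by positivity
    have e : Real.pi = √Real.pi ^ 2 := by rw [Real.sq_sqrt Real.pi_pos.le]
    have e2 : √2 ^ 2 = (2:ℝ) := Real.sq_sqrt (by norm_num)
    rw [e, Real.sqrt_sq a.le]
    field_simp
    rw [e2]
    ring
  rw [h3, ← h4]
  linarith

lemma aux_law {d : ℕ} (P : Measure (EuclideanSpace ℝ (Fin d)))
    (m : EuclideanSpace ℝ (Fin d)) (S : Matrix (Fin d) (Fin d) ℝ)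
    (hP : IsGaussianMeasure P m S) (hpsd : S.PosSemidef) : P = multivariateGaussian m S := by
  obtain ⟨hp, h⟩ := hP
  apply Measure.ext_of_charFun
  ext t
  rw [charFun_multivariateGaussian hpsd, charFun_apply]
  have h1 := h t
  have e1 : ∀ x : EuclideanSpace ℝ (Fin d), inner ℝ x t = ∑ i, t i * x i := by
    intro x; simp [PiLp.inner_apply]
  have e2 : inner ℝ t m = ∑ i, m i * t i := by simp [PiLp.inner_apply]
  have e3 : t ⬝ᵥ S.mulVec t = ∑ i, ∑ j, S i j * t i * t j := by
    simp only [dotProduct, Matrix.mulVec, Finset.mul_sum]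
    refine Finset.sum_congr rfl fun i _ => Finset.sum_congr rfl fun j _ => by ring
  simp_rw [e1, e2, e3, mul_comm _ Complex.I]
  exact h1

/-- If `X ~ N(μ, Σ)`, `f` is Lipschitz with `E f(X) = 0` and `‖Σ^{1/2}∇f‖_∞ ≤ L`, then
`E f(X)⁺ ≤ (√π / (2√2)) L`. -/
theorem stmt19 {d : ℕ} (P : Measure (EuclideanSpace ℝ (Fin d)))
    (m : EuclideanSpace ℝ (Fin d)) (S : Matrix (Fin d) (Fin d) ℝ)
    (hP : IsGaussianMeasure P m S) (hS : S.IsSymm) (hpsd : S.PosSemidef)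
    (f : EuclideanSpace ℝ (Fin d) → ℝ) (C : NNReal) (hf : LipschitzWith C f)
    (hmean : ∫ y, f y ∂P = 0) (L : ℝ) (hL : 0 ≤ L)
    (hgrad : ∀ y, DifferentiableAt ℝ f y →
      ∑ i, ∑ j, S i j * gradient f y i * gradient f y j ≤ L ^ 2) :
    ∫ y, max (f y) 0 ∂P ≤ (Real.sqrt Real.pi / (2 * Real.sqrt 2)) * L := by
  have hlaw := aux_law P m S hP hpsd
  have hfc := hf.continuous
  obtain ⟨A, hAs, hAA, hmap⟩ : ∃ A : Matrix (Fin d) (Fin d) ℝ, A.transpose = A ∧ A * A = S ∧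
      P = (stdGaussian (EuclideanSpace ℝ (Fin d))).map
        (fun x => m + Matrix.toEuclideanCLM (𝕜 := ℝ) A x) := by
    open scoped MatrixOrder in
    refine ⟨CFC.sqrt S, ?_, CFC.sqrt_mul_sqrt_self S hpsd.nonneg, hlaw⟩
    have := (CFC.sqrt_nonneg S).isSelfAdjoint
    rw [← Matrix.conjTranspose_eq_transpose_of_trivial]
    exact this
  set T := Matrix.toEuclideanCLM (𝕜 := ℝ) A with hT
  have hnorm : ∀ w : EuclideanSpace ℝ (Fin d), ‖T w‖ ^ 2 = ∑ i, ∑ j, S i j * w i * w j := by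
    intro w
    have h1 : ‖T w‖ ^ 2 = A.mulVec w ⬝ᵥ A.mulVec w := by
      rw [EuclideanSpace.real_norm_sq_eq]
      simp [hT, dotProduct, sq]
    rw [h1, Matrix.dotProduct_mulVec, ← Matrix.mulVec_transpose, hAs, Matrix.mulVec_mulVec, hAA]
    simp only [dotProduct, Matrix.mulVec, Finset.sum_mul]
    refine Finset.sum_congr rfl fun i _ => Finset.sum_congr rfl fun j _ => by ring
  have hadj : ∀ u w : EuclideanSpace ℝ (Fin d), inner ℝ u (T w) = inner ℝ (T u) w := by
    intro u w
    have h1 : inner ℝ u (T w) = A.mulVec w ⬝ᵥ u := by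
      simp [hT, PiLp.inner_apply, dotProduct]
    have h2 : inner ℝ (T u) w = w ⬝ᵥ A.mulVec u := by
      simp [hT, PiLp.inner_apply, dotProduct]
    rw [h1, h2, Matrix.dotProduct_mulVec, ← Matrix.mulVec_transpose, hAs]
  have hlip : LipschitzWith (Real.toNNReal L) (fun w => f (m + T w)) := by
    refine LipschitzWith.of_dist_le_mul fun a b => ?_
    rw [Real.coe_toNNReal _ hL, Real.dist_eq, dist_eq_norm]
    have := aux_lip f C hf (T (a - b)) (L * ‖a - b‖) ?_ (m + T b)
    · rw [show m + T b + T (a - b) = m + T a by rw [map_sub]; abel] at this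
      exact this
    · intro y hy
      have h1 : fderiv ℝ f y (T (a - b)) = inner ℝ (gradient f y) (T (a - b)) := by
        simp [gradient]
      rw [h1, hadj]
      refine (abs_real_inner_le_norm _ _).trans ?_
      gcongr
      refine abs_le_of_sq_le_sq' ?_ hL |>.2
      rw [hnorm]
      exact hgrad y hy
  have hTc : Measurable (fun x => m + T x) := by fun_prop
  rw [hmap, integral_map hTc.aemeasurable (by fun_prop)] at hmean ⊢
  have := aux_main _ _ hlip hmean
  rwa [Real.coe_toNNReal _ hL] at this
end
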